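/- arXiv:1801.05884 — 4 statements merged into one kernel-verified Lean document; each statement's English description precedes it below -/
import Mathlib

section
/- There exists a martingale d with d([]) ≤ 4 that succeeds on the characteristic sequence χ_L of every language L with the following property: for infinitely many natural numbers n ≥ 16, the DNF width of L n is at most n·(1 − 2·log₂(log₂ n)/log₂ n) (where log₂ denotes the real base-2 logarithm and the DNF width, a natural number, is compared with this real value). -/
/-- `f` has DNF width at most `k`: the set `{x | f x = true}` is a union of subcubes,
each given by a center `p.1` and a set of fixed coordinates `p.2` of size at most `k`. -/
def HasDnfWidthLE {n : ℕ} (f : (Fin n → Bool) → Bool) (k : ℕ) : Prop :=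
  ∃ C : Set ((Fin n → Bool) × Finset (Fin n)),
    (∀ p ∈ C, p.2.card ≤ k) ∧
    {x | f x = true} = ⋃ p ∈ C, {y | ∀ i ∈ p.2, y i = p.1 i}

/-- The DNF width of `f`: the least `k` such that `f` has DNF width at most `k`. -/
noncomputable def dnfWidth {n : ℕ} (f : (Fin n → Bool) → Bool) : ℕ :=
  sInf {k | HasDnfWidthLE f k}

/-- A martingale: nonnegative and satisfying the averaging condition. -/
def IsMartingale (d : List Bool → ℝ) : Prop :=
  (∀ w, 0 ≤ d w) ∧ ∀ w, d w = (d (w ++ [false]) + d (w ++ [true])) / 2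

/-- `d` succeeds on `χ`: its values on prefixes of `χ` are unbounded. -/
def Succeeds (d : List Bool → ℝ) (χ : ℕ → Bool) : Prop :=
  ∀ C : ℝ, ∃ k : ℕ, C < d (List.ofFn fun i : Fin k => χ i)

/-- `natToBits n m` is the `n`-bit binary representation of `m`, most significant bit first. -/
def natToBits (n m : ℕ) : Fin n → Bool := fun i => m.testBit (n - 1 - (i : ℕ))

/-- `χ` is the characteristic sequence of the language `L`:
`χ (2^n - 1 + m) = L n x_m` for `0 ≤ m < 2^n`. -/
def IsCharSeq (L : ∀ n : ℕ, (Fin n → Bool) → Bool) (χ : ℕ → Bool) : Prop :=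
  ∀ n m : ℕ, m < 2 ^ n → χ (2 ^ n - 1 + m) = L n (natToBits n m)

noncomputable section Helpers

def cellW (b : Bool) (w : List Bool) (i : ℕ) : ℝ :=
  match w[i]? with
  | none => 1 / 2
  | some c => if c = b then 1 else 0

def testM (T : Finset ℕ) (b : Bool) (w : List Bool) : ℝ := ∏ i ∈ T, cellW b w i

lemma cellW_nonneg (b w i) : 0 ≤ cellW b w i := by
  unfold cellW
  split
  · norm_num
  · split <;> norm_num

lemma cellW_append (b c : Bool) (w : List Bool) (i : ℕ) (h : i ≠ w.length) :
    cellW b (w ++ [c]) i = cellW b w i := by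
  unfold cellW
  have : (w ++ [c])[i]? = w[i]? := by
    rcases lt_or_gt_of_ne h with h | h
    · rw [List.getElem?_append_left h]
    · rw [List.getElem?_eq_none (by simp; omega), List.getElem?_eq_none (by omega)]
  rw [this]

lemma testM_nonneg (T b w) : 0 ≤ testM T b w :=
  Finset.prod_nonneg fun i _ => cellW_nonneg b w i

lemma testM_avg (T b) (w : List Bool) :
    testM T b w = (testM T b (w ++ [false]) + testM T b (w ++ [true])) / 2 := by
  unfold testM
  by_cases h : w.length ∈ T
  · have key : ∀ c, ∏ i ∈ T.erase w.length, cellW b (w ++ [c]) i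
        = ∏ i ∈ T.erase w.length, cellW b w i := fun c =>
      Finset.prod_congr rfl fun i hi => cellW_append b c w i (Finset.ne_of_mem_erase hi)
    rw [← Finset.mul_prod_erase T (cellW b w) h,
      ← Finset.mul_prod_erase T (cellW b (w ++ [false])) h,
      ← Finset.mul_prod_erase T (cellW b (w ++ [true])) h, key, key]
    have h0 : cellW b w w.length = 1 / 2 := by simp [cellW]
    have h1 : ∀ c, cellW b (w ++ [c]) w.length = if c = b then 1 else 0 := by
      intro c; simp [cellW]
    rw [h0, h1, h1]
    cases b <;> simp <;> ring
  · have key : ∀ c, ∏ i ∈ T, cellW b (w ++ [c]) i = ∏ i ∈ T, cellW b w i := fun c =>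
      Finset.prod_congr rfl fun i hi => cellW_append b c w i (fun e => h (e ▸ hi))
    rw [key, key]; ring

lemma testM_nil (T b) : testM T b [] = (1 / 2 : ℝ) ^ T.card := by
  simp [testM, cellW]

lemma testM_one (T : Finset ℕ) (b : Bool) (χ : ℕ → Bool) (k : ℕ) (hk : ∀ i ∈ T, i < k)
    (h : ∀ i ∈ T, χ i = b) : testM T b (List.ofFn fun i : Fin k => χ i) = 1 := by
  unfold testM
  refine Finset.prod_eq_one fun i hi => ?_
  have : (List.ofFn fun i : Fin k => χ i)[i]? = some (χ i) := by
    simp [hk i hi]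
  simp [cellW, this, h i hi]

def cubeT (n : ℕ) (p : (Fin n → Bool) × Finset (Fin n)) : Finset ℕ := by
  classical
  exact ((Finset.range (2 ^ n)).filter fun m => ∀ i ∈ p.2, natToBits n m i = p.1 i).image
    (fun m => 2 ^ n - 1 + m)

def blockT (n : ℕ) : Finset ℕ := (Finset.range (2 ^ n)).image (fun m => 2 ^ n - 1 + m)

def famP (n : ℕ) : Finset ((Fin n → Bool) × Finset (Fin n)) := by
  classical
  exact Finset.univ.filter fun p => 3 * n ≤ (cubeT n p).card

def termM (n : ℕ) (w : List Bool) : ℝ :=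
  testM (blockT n) false w + ∑ p ∈ famP n, testM (cubeT n p) true w

lemma termM_nonneg (n w) : 0 ≤ termM n w :=
  add_nonneg (testM_nonneg _ _ _) (Finset.sum_nonneg fun _ _ => testM_nonneg _ _ _)

lemma termM_avg (n) (w : List Bool) :
    termM n w = (termM n (w ++ [false]) + termM n (w ++ [true])) / 2 := by
  unfold termM
  rw [testM_avg (blockT n) false w,
    Finset.sum_congr rfl (fun p _ => testM_avg (cubeT n p) true w), ← Finset.sum_div,
    Finset.sum_add_distrib]
  ring

lemma blockT_card (n) : (blockT n).card = 2 ^ n := by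
  unfold blockT
  rw [Finset.card_image_of_injective _ (add_right_injective _), Finset.card_range]

lemma termM_nil (n) : termM n [] ≤ 2 * (1 / 2 : ℝ) ^ n := by
  unfold termM
  rw [testM_nil, blockT_card]
  have h1 : (1 / 2 : ℝ) ^ (2 ^ n) ≤ (1 / 2) ^ n :=
    pow_le_pow_of_le_one (by norm_num) (by norm_num) Nat.lt_two_pow_self.le
  have h2 : ∑ p ∈ famP n, testM (cubeT n p) true [] ≤ (1 / 2 : ℝ) ^ n := by
    calc ∑ p ∈ famP n, testM (cubeT n p) true []
        ≤ ∑ p ∈ famP n, (1 / 2 : ℝ) ^ (3 * n) := by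
          refine Finset.sum_le_sum fun p hp => ?_
          rw [testM_nil]
          refine pow_le_pow_of_le_one (by norm_num) (by norm_num) ?_
          simpa [famP] using hp
      _ = (famP n).card * (1 / 2 : ℝ) ^ (3 * n) := by simp
      _ ≤ (4 : ℝ) ^ n * (1 / 2 : ℝ) ^ (3 * n) := by
          gcongr
          have : (famP n).card ≤ 4 ^ n := by
            refine (Finset.card_le_univ _).trans ?_
            simp [← mul_pow]
          exact_mod_cast this
      _ = (1 / 2 : ℝ) ^ n := by
          rw [pow_mul, ← mul_pow]; norm_num
  linarith

lemma termM_le (n) (w : List Bool) : termM n w ≤ 2 ^ w.length * termM n [] := by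
  induction w using List.reverseRecOn with
  | nil => simp
  | append_singleton w c ih =>
    have h := termM_avg n w
    have h0 := termM_nonneg n (w ++ [false])
    have h1 := termM_nonneg n (w ++ [true])
    have : termM n (w ++ [c]) ≤ 2 * termM n w := by cases c <;> linarith
    rw [List.length_append, List.length_singleton, pow_succ]
    linarith

lemma termM_summable (w : List Bool) : Summable fun n => termM n w := by
  refine Summable.of_nonneg_of_le (fun n => termM_nonneg n w)
    (fun n => (termM_le n w).trans (mul_le_mul_of_nonneg_left (termM_nil n) (by positivity))) ?_
  exact ((summable_geometric_two).mul_left 2).mul_left _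

lemma natToBits_surj (n : ℕ) (y : Fin n → Bool) : ∃ m < 2 ^ n, natToBits n m = y := by
  have inj : Function.Injective (fun m : Fin (2 ^ n) => natToBits n m) := by
    intro a b hab
    apply Fin.ext
    apply Nat.eq_of_testBit_eq
    intro i
    by_cases hi : i < n
    · have := congrFun hab ⟨n - 1 - i, by omega⟩
      simp only [natToBits] at this
      rwa [show n - 1 - (n - 1 - i) = i by omega] at this
    · have hle : 2 ^ n ≤ 2 ^ i := Nat.pow_le_pow_right (by norm_num) (by omega)
      rw [Nat.testBit_lt_two_pow (a.2.trans_le hle), Nat.testBit_lt_two_pow (b.2.trans_le hle)]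
  have bij := (Fintype.bijective_iff_injective_and_card _).2 ⟨inj, by simp⟩
  obtain ⟨m, hm⟩ := bij.2 y
  exact ⟨m, m.2, hm⟩

lemma cubeT_card (n : ℕ) (p : (Fin n → Bool) × Finset (Fin n)) :
    2 ^ (n - p.2.card) ≤ (cubeT n p).card := by
  classical
  unfold cubeT
  rw [Finset.card_image_of_injective _ (add_right_injective _)]
  have h1 : (Fintype.piFinset (fun i => if i ∈ p.2 then {p.1 i} else (Finset.univ : Finset Bool))).card
      = 2 ^ (n - p.2.card) := by
    rw [Fintype.card_piFinset]
    have : ∀ i, (if i ∈ p.2 then {p.1 i} else (Finset.univ : Finset Bool)).card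
        = if i ∈ p.2 then 1 else 2 := by
      intro i; split <;> simp
    simp only [this]
    rw [Finset.prod_ite]
    have e : (Finset.univ.filter fun i => i ∉ p.2) = p.2ᶜ := by ext; simp
    rw [e]
    simp [Finset.card_compl]
  rw [← h1]
  refine le_trans (Finset.card_le_card ?_) (Finset.card_image_le (f := natToBits n))
  intro y hy
  obtain ⟨m, hm, rfl⟩ := natToBits_surj n y
  refine Finset.mem_image.2 ⟨m, ?_, rfl⟩
  rw [Finset.mem_filter, Finset.mem_range]
  refine ⟨hm, fun i hi => ?_⟩
  have := Fintype.mem_piFinset.1 hy i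
  simpa [hi] using this

lemma dnf_full {n : ℕ} (f : (Fin n → Bool) → Bool) : HasDnfWidthLE f n := by
  refine ⟨{p | f p.1 = true ∧ p.2 = Finset.univ}, fun p hp => ?_, ?_⟩
  · rw [hp.2]; simp
  · ext x
    simp only [Set.mem_setOf_eq, Set.mem_iUnion]
    constructor
    · intro h
      exact ⟨(x, Finset.univ), ⟨h, rfl⟩, fun i _ => rfl⟩
    · rintro ⟨p, ⟨h1, h2⟩, h3⟩
      have : x = p.1 := funext fun i => h3 i (by simp [h2])
      rw [this]; exact h1

lemma arith_bound (n k : ℕ) (hn : 16 ≤ n) (hk : (k : ℝ) ≤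
    (n : ℝ) * (1 - 2 * Real.logb 2 (Real.logb 2 (n : ℝ)) / Real.logb 2 (n : ℝ))) :
    3 * n ≤ 2 ^ (n - k) := by
  set l := Real.logb 2 (n : ℝ) with hl
  have hn0 : (0 : ℝ) < n := by exact_mod_cast (by omega : 0 < n)
  have hnr : (16 : ℝ) ≤ n := by exact_mod_cast hn
  have h4 : 4 ≤ l := by
    rw [hl, Real.le_logb_iff_rpow_le (by norm_num) hn0]
    norm_num; exact hn
  have h2 : 2 ≤ Real.logb 2 l := by
    rw [Real.le_logb_iff_rpow_le (by norm_num) (by linarith)]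
    norm_num; exact h4
  have hj : (l ^ 2 + 2 * l) ≤ 4 * n := by
    have a1 : 2 ^ Nat.log 2 n ≤ n := Nat.pow_log_le_self 2 (by omega)
    have a2 : n < 2 ^ (Nat.log 2 n + 1) := Nat.lt_pow_succ_log_self (by norm_num) n
    have a3 : 4 ≤ Nat.log 2 n := Nat.le_log_of_pow_le (by norm_num) (by simpa using hn)
    generalize Nat.log 2 n = j at a1 a2 a3
    have a4 : l ≤ j + 1 := by
      rw [hl, Real.logb_le_iff_le_rpow (by norm_num) hn0]
      have : (n : ℝ) ≤ (2 : ℝ) ^ (j + 1 : ℕ) := by exact_mod_cast a2.le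
      rw [← Real.rpow_natCast] at this
      simpa using this
    have a5 : (j + 1) ^ 2 + 2 * (j + 1) ≤ 4 * 2 ^ j := by
      clear a1 a2 a4
      induction j, a3 using Nat.le_induction with
      | base => norm_num
      | succ j hj ih => rw [pow_succ 2 j]; nlinarith
    have a6 : ((j : ℝ) + 1) ^ 2 + 2 * (j + 1) ≤ 4 * n := by
      exact_mod_cast a5.trans (by omega)
    nlinarith
  have hb : (n : ℝ) * (1 - 2 * Real.logb 2 l / l) ≤ n - (l + 2) := by
    have e : 2 * Real.logb 2 l / l ≥ 4 / l := by gcongr; linarith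
    have e2 : (n : ℝ) * (4 / l) ≥ l + 2 := by
      rw [ge_iff_le, ← mul_div_assoc, le_div_iff₀ (by linarith)]; nlinarith
    nlinarith
  have hkn : k ≤ n := by
    have : (k : ℝ) ≤ n := by linarith
    exact_mod_cast this
  have hfin : (3 * n : ℝ) ≤ 2 ^ (n - k) := by
    rw [← Real.rpow_natCast, Nat.cast_sub hkn]
    calc (3 * n : ℝ) ≤ n * 4 := by linarith
      _ = (2 : ℝ) ^ (l + 2) := by
        rw [Real.rpow_add (by norm_num), hl, Real.rpow_logb (by norm_num) (by norm_num) hn0]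
        norm_num
      _ ≤ _ := Real.rpow_le_rpow_of_exponent_le (by norm_num) (by linarith)
  exact_mod_cast hfin

lemma termM_one (L : ∀ n : ℕ, (Fin n → Bool) → Bool) (χ : ℕ → Bool) (hχ : IsCharSeq L χ)
    (n : ℕ) (hn : 16 ≤ n) (hd : (dnfWidth (L n) : ℝ) ≤
      (n : ℝ) * (1 - 2 * Real.logb 2 (Real.logb 2 (n : ℝ)) / Real.logb 2 (n : ℝ)))
    (k : ℕ) (hk : 2 ^ (n + 1) ≤ k) :
    1 ≤ termM n (List.ofFn fun i : Fin k => χ i) := by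
  have hb := arith_bound n _ hn hd
  have hlt : ∀ m < 2 ^ n, 2 ^ n - 1 + m < k := by
    intro m hm; rw [pow_succ] at hk; omega
  obtain ⟨C, hC, hU⟩ : HasDnfWidthLE (L n) (dnfWidth (L n)) :=
    Nat.sInf_mem (s := {k | HasDnfWidthLE (L n) k}) ⟨n, dnf_full _⟩
  unfold termM
  rcases C.eq_empty_or_nonempty with rfl | ⟨p, hp⟩
  · have hf : ∀ x, L n x = false := by
      intro x
      have : x ∉ {x | L n x = true} := by rw [hU]; simp
      simpa using this
    rw [testM_one (blockT n) false χ k]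
    · have := Finset.sum_nonneg (s := famP n) fun p _ =>
        testM_nonneg (cubeT n p) true (List.ofFn fun i : Fin k => χ i)
      linarith
    · intro i hi
      obtain ⟨m, hm, rfl⟩ := Finset.mem_image.1 hi
      exact hlt m (Finset.mem_range.1 hm)
    · intro i hi
      obtain ⟨m, hm, rfl⟩ := Finset.mem_image.1 hi
      rw [hχ n m (Finset.mem_range.1 hm), hf]
  · have hmem : p ∈ famP n := by
      simp only [famP, Finset.mem_filter, Finset.mem_univ, true_and]
      refine hb.trans (le_trans ?_ (cubeT_card n p))
      exact Nat.pow_le_pow_right (by norm_num) (Nat.sub_le_sub_left (hC p hp) n)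
    have h1 := Finset.single_le_sum (f := fun p => testM (cubeT n p) true
      (List.ofFn fun i : Fin k => χ i)) (fun p _ => testM_nonneg _ _ _) hmem
    have h2 := testM_nonneg (blockT n) false (List.ofFn fun i : Fin k => χ i)
    have h3 : testM (cubeT n p) true (List.ofFn fun i : Fin k => χ i) = 1 := by
      apply testM_one
      · intro i hi
        obtain ⟨m, hm, rfl⟩ := Finset.mem_image.1 hi
        exact hlt m (Finset.mem_range.1 (Finset.mem_filter.1 hm).1)
      · intro i hi
        obtain ⟨m, hm, rfl⟩ := Finset.mem_image.1 hi
        obtain ⟨hm1, hm2⟩ := Finset.mem_filter.1 hm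
        rw [hχ n m (Finset.mem_range.1 hm1)]
        have : natToBits n m ∈ {x | L n x = true} := by
          rw [hU]
          simp only [Set.mem_iUnion]
          exact ⟨p, hp, hm2⟩
        exact this
    linarith

end Helpers

theorem sublinear_dnf_width_measure_zero :
    ∃ d : List Bool → ℝ, IsMartingale d ∧ d [] ≤ 4 ∧
      ∀ L : (∀ n : ℕ, (Fin n → Bool) → Bool), ∀ χ : ℕ → Bool, IsCharSeq L χ →
        {n : ℕ | 16 ≤ n ∧ (dnfWidth (L n) : ℝ) ≤
            (n : ℝ) * (1 - 2 * Real.logb 2 (Real.logb 2 (n : ℝ)) / Real.logb 2 (n : ℝ))}.Infinite →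
        Succeeds d χ := by
  refine ⟨fun w => ∑' n, termM n w, ⟨fun w => tsum_nonneg fun n => termM_nonneg n w, ?_⟩, ?_, ?_⟩
  · intro w
    simp only
    rw [← (termM_summable _).tsum_add (termM_summable _), ← tsum_div_const]
    exact tsum_congr fun n => termM_avg n w
  · have h := (termM_summable []).tsum_le_tsum termM_nil (summable_geometric_two.mul_left 2)
    rw [tsum_mul_left, tsum_geometric_two] at h
    simp only
    linarith
  · intro L χ hχ hinf C
    obtain ⟨N, hN⟩ := exists_nat_gt C
    obtain ⟨s, hs, hc⟩ := hinf.exists_subset_card_eq N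
    refine ⟨2 ^ (s.sup id + 1), ?_⟩
    refine lt_of_lt_of_le hN ?_
    refine le_trans ?_ ((termM_summable _).sum_le_tsum s fun n _ => termM_nonneg n _)
    have : (N : ℝ) = ∑ n ∈ s, (1 : ℝ) := by simp [hc]
    rw [this]
    refine Finset.sum_le_sum fun n hn => ?_
    obtain ⟨h1, h2⟩ := hs hn
    refine termM_one L χ hχ n h1 h2 _ (Nat.pow_le_pow_right (by norm_num) ?_)
    have := Finset.le_sup (f := id) hn
    simpa using this
end

section
/- Let d be a martingale. Then the set {χ : ℕ → Bool | d succeeds on χ} is a null set with respect to the fair-coin measure μ on ℕ → Bool, i.e., it is contained in a measurable set of μ-measure zero. -/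
open MeasureTheory

/-- `μ` is the fair-coin measure on `ℕ → Bool`: the infinite product of uniform measures
on `Bool`, characterized as the probability measure giving each cylinder (a constraint on
finitely many coordinates) measure `2^{-(number of constrained coordinates)}`. -/
def IsFairCoin (μ : Measure (ℕ → Bool)) : Prop :=
  IsProbabilityMeasure μ ∧
    ∀ (s : Finset ℕ) (g : ℕ → Bool),
      μ {χ : ℕ → Bool | ∀ i ∈ s, χ i = g i} = (1 / 2 : ENNReal) ^ s.card

def pfx (χ : ℕ → Bool) (k : ℕ) : List Bool := List.ofFn fun i : Fin k => χ i

lemma pfx_succ (χ : ℕ → Bool) (k : ℕ) : pfx χ (k + 1) = pfx χ k ++ [χ k] := by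
  unfold pfx
  rw [List.ofFn_succ_last]
  rfl

lemma cyl_le (μ : Measure (ℕ → Bool)) (hμ : IsFairCoin μ) (w : List Bool) :
    μ {χ | pfx χ w.length = w} ≤ ENNReal.ofReal ((1 / 2) ^ w.length) := by
  have h := hμ.2 (Finset.range w.length) (fun i => w.getD i false)
  have e : ENNReal.ofReal ((1 / 2) ^ w.length) = (1 / 2 : ENNReal) ^ w.length := by
    rw [ENNReal.ofReal_pow (by norm_num)]
    congr 1
    rw [ENNReal.ofReal_div_of_pos (by norm_num)]
    simp
  rw [Finset.card_range] at h
  rw [e, ← h]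
  apply measure_mono
  intro χ hχ i hi
  have hi' : i < w.length := Finset.mem_range.1 hi
  have hχ' : pfx χ w.length = w := hχ
  have h2 : (pfx χ w.length).getD i false = w.getD i false := by rw [hχ']
  rw [← h2]
  simp [pfx, List.getD_eq_getElem?_getD, List.getElem?_ofFn, hi']

lemma ville_fin (μ : Measure (ℕ → Bool)) (hμ : IsFairCoin μ)
    (d : List Bool → ℝ) (hd : IsMartingale d) (C : ℝ) (hC : 0 < C) (n : ℕ) :
    ∀ w : List Bool, μ {χ | pfx χ w.length = w ∧ ∃ k ≤ n, C < d (pfx χ (w.length + k))} ≤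
      ENNReal.ofReal (d w / C * (1 / 2) ^ w.length) := by
  induction n with
  | zero =>
    intro w
    by_cases h : C < d w
    · refine (measure_mono (fun χ hχ => hχ.1)).trans ((cyl_le μ hμ w).trans ?_)
      apply ENNReal.ofReal_le_ofReal
      have : 1 ≤ d w / C := by rw [le_div_iff₀ hC]; linarith
      exact le_mul_of_one_le_left (by positivity) this
    · have : {χ | pfx χ w.length = w ∧ ∃ k ≤ 0, C < d (pfx χ (w.length + k))} = ∅ := by
        ext χ
        simp only [Set.mem_ofPred_eq, Set.mem_empty_iff_false, iff_false]
        rintro ⟨h1, k, hk, h2⟩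
        obtain rfl : k = 0 := by omega
        rw [add_zero, h1] at h2
        exact h h2
      rw [this]; simp
  | succ n ih =>
    intro w
    by_cases h : C < d w
    · refine (measure_mono (fun χ hχ => hχ.1)).trans ((cyl_le μ hμ w).trans ?_)
      apply ENNReal.ofReal_le_ofReal
      have : 1 ≤ d w / C := by rw [le_div_iff₀ hC]; linarith
      exact le_mul_of_one_le_left (by positivity) this
    · have hs : {χ | pfx χ w.length = w ∧ ∃ k ≤ n + 1, C < d (pfx χ (w.length + k))} ⊆
          {χ | pfx χ (w ++ [false]).length = w ++ [false] ∧
            ∃ k ≤ n, C < d (pfx χ ((w ++ [false]).length + k))} ∪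
          {χ | pfx χ (w ++ [true]).length = w ++ [true] ∧
            ∃ k ≤ n, C < d (pfx χ ((w ++ [true]).length + k))} := by
        rintro χ ⟨h1, k, hk, h2⟩
        have hk0 : k ≠ 0 := by
          rintro rfl
          rw [add_zero, h1] at h2
          exact h h2
        obtain ⟨j, rfl⟩ := Nat.exists_eq_succ_of_ne_zero hk0
        have key : ∀ b, χ w.length = b → (pfx χ (w ++ [b]).length = w ++ [b] ∧
            ∃ k ≤ n, C < d (pfx χ ((w ++ [b]).length + k))) := by
          intro b hb
          have hl : (w ++ [b]).length = w.length + 1 := by simp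
          rw [hl]
          refine ⟨by rw [pfx_succ, h1, hb], j, by omega, ?_⟩
          have : w.length + 1 + j = w.length + j.succ := by omega
          rw [this]; exact h2
        cases hb : χ w.length with
        | false => exact Or.inl (key _ hb)
        | true => exact Or.inr (key _ hb)
      refine (measure_mono hs).trans ((measure_union_le _ _).trans
        ((add_le_add (ih _) (ih _)).trans ?_))
      have h0 := hd.1 (w ++ [false])
      have h1 := hd.1 (w ++ [true])
      rw [← ENNReal.ofReal_add (by positivity) (by positivity)]
      apply ENNReal.ofReal_le_ofReal
      rw [hd.2 w]
      simp only [List.length_append, List.length_singleton, pow_succ]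
      apply le_of_eq
      ring

lemma ville (μ : Measure (ℕ → Bool)) (hμ : IsFairCoin μ)
    (d : List Bool → ℝ) (hd : IsMartingale d) (C : ℝ) (hC : 0 < C) :
    μ {χ | Succeeds d χ} ≤ ENNReal.ofReal (d [] / C) := by
  have hs : {χ | Succeeds d χ} ⊆ ⋃ n : ℕ, {χ | ∃ k ≤ n, C < d (pfx χ k)} := by
    intro χ hχ
    obtain ⟨k, hk⟩ := hχ C
    exact Set.mem_iUnion.2 ⟨k, k, le_rfl, hk⟩
  refine (measure_mono hs).trans ?_
  rw [Monotone.measure_iUnion]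
  · refine iSup_le fun n => ?_
    have := ville_fin μ hμ d hd C hC n []
    simpa [pfx] using this
  · rintro a b hab χ ⟨k, hk, h⟩
    exact ⟨k, hk.trans hab, h⟩

theorem success_set_null (μ : Measure (ℕ → Bool)) (hμ : IsFairCoin μ)
    (d : List Bool → ℝ) (hd : IsMartingale d) :
    ∃ A : Set (ℕ → Bool), MeasurableSet A ∧ μ A = 0 ∧ {χ | Succeeds d χ} ⊆ A := by
  refine ⟨toMeasurable μ {χ | Succeeds d χ}, measurableSet_toMeasurable _ _, ?_,
    subset_toMeasurable _ _⟩
  rw [measure_toMeasurable]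
  have ht : Filter.Tendsto (fun n : ℕ => ENNReal.ofReal (d [] / ((n : ℝ) + 1))) Filter.atTop
      (nhds (ENNReal.ofReal 0)) := by
    apply ENNReal.tendsto_ofReal
    have := (tendsto_one_div_add_atTop_nhds_zero_nat (𝕜 := ℝ)).const_mul (d [])
    simpa [div_eq_mul_inv] using this
  have := ge_of_tendsto' ht (fun n => ville μ hμ d hd (n + 1) (by positivity))
  simpa using this
end

section
/- A set C ⊆ (ℕ → Bool) is a null set with respect to the fair-coin measure μ (i.e., C is contained in a measurable set of μ-measure zero) if and only if there exists a martingale d that succeeds on every χ ∈ C. -/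
open MeasureTheory

def preM (χ : ℕ → Bool) (k : ℕ) : List Bool := List.ofFn fun i : Fin k => χ i

lemma preM_length (χ : ℕ → Bool) (k : ℕ) : (preM χ k).length = k := by simp [preM]

lemma preM_succ (χ : ℕ → Bool) (k : ℕ) : preM χ (k+1) = preM χ k ++ [χ k] := by
  rw [preM, List.ofFn_succ', List.concat_eq_append]; rfl

def cylM (w : List Bool) : Set (ℕ → Bool) := {χ | preM χ w.length = w}

lemma mem_cylM_append (w : List Bool) (b : Bool) (χ : ℕ → Bool) :
    χ ∈ cylM (w ++ [b]) ↔ χ ∈ cylM w ∧ χ w.length = b := by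
  simp only [cylM, Set.mem_ofPred_eq, List.length_append, List.length_singleton, preM_succ]
  constructor
  · intro h
    have := List.append_inj h (by simp [preM_length])
    simpa using this
  · rintro ⟨h1, h2⟩
    rw [h1, h2]

lemma cylM_eq (w : List Bool) :
    cylM w = {χ | ∀ i ∈ Finset.range w.length, χ i = w.getD i false} := by
  ext χ
  simp only [cylM, Set.mem_ofPred_eq, Finset.mem_range]
  constructor
  · intro h i hi
    conv_rhs => rw [← h]
    simp [preM, List.getD, hi]
  · intro h
    apply List.ext_getElem
    · simp [preM]
    · intro i h1 h2
      have := h i h2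
      simp [preM, this, List.getD, h2]

lemma mu_cylM {μ : Measure (ℕ → Bool)} (hμ : IsFairCoin μ) (w : List Bool) :
    μ (cylM w) = (1 / 2 : ENNReal) ^ w.length := by
  rw [cylM_eq, hμ.2]; simp

lemma measurable_cylM (w : List Bool) : MeasurableSet (cylM w) := by
  rw [cylM_eq]
  have : {χ : ℕ → Bool | ∀ i ∈ Finset.range w.length, χ i = w.getD i false}
    = ⋂ i ∈ Finset.range w.length, (fun χ : ℕ → Bool => χ i) ⁻¹' {w.getD i false} := by
    ext; simp
  rw [this]
  exact Finset.measurableSet_biInter _ fun i _ => measurable_pi_apply i (measurableSet_singleton _)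

lemma cylM_split (w : List Bool) : cylM w = cylM (w ++ [false]) ∪ cylM (w ++ [true]) := by
  ext χ
  simp only [Set.mem_union, mem_cylM_append]
  cases χ w.length <;> simp

lemma cylM_disj (w : List Bool) : Disjoint (cylM (w ++ [false])) (cylM (w ++ [true])) := by
  rw [Set.disjoint_left]
  intro χ h1 h2
  rw [mem_cylM_append] at h1 h2
  simp [h1.2] at h2

lemma open_cylM {U : Set (ℕ → Bool)} (hU : IsOpen U) {χ : ℕ → Bool} (h : χ ∈ U) :
    ∃ k, cylM (preM χ k) ⊆ U := by
  rw [isOpen_pi_iff] at hU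
  obtain ⟨I, u, hu, hs⟩ := hU χ h
  refine ⟨I.sup id + 1, fun ψ hψ => hs ?_⟩
  intro i hi
  have hi' : i < I.sup id + 1 := Nat.lt_succ_of_le (Finset.le_sup (f := id) hi)
  have : ψ i = χ i := by
    rw [cylM_eq] at hψ
    have := hψ i (by simpa [preM_length] using hi')
    rw [this, List.getD_eq_getElem _ _ (by simpa [preM_length] using hi')]
    simp only [preM, List.getElem_ofFn]
  rw [this]
  exact (hu i hi).2

lemma ville_s6 {μ : Measure (ℕ → Bool)} (hμ : IsFairCoin μ) {d : List Bool → ℝ}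
    (hd : IsMartingale d) (c : ℝ) (n : ℕ) : ∀ w : List Bool,
    ENNReal.ofReal c * μ {χ | χ ∈ cylM w ∧ ∃ k ≤ n, c < d (preM χ (w.length + k))} ≤
      ENNReal.ofReal (d w) * (1 / 2) ^ w.length := by
  induction n with
  | zero =>
    intro w
    by_cases hc : c < d w
    · rw [← mu_cylM hμ]
      gcongr
      intro χ h; exact h.1
    · have : {χ | χ ∈ cylM w ∧ ∃ k ≤ 0, c < d (preM χ (w.length + k))} = ∅ := by
        ext χ
        simp only [Set.mem_ofPred_eq, Set.mem_empty_iff_false, iff_false]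
        rintro ⟨h1, k, hk, h⟩
        obtain rfl : k = 0 := by omega
        rw [add_zero, show preM χ w.length = w from h1] at h
        exact hc h
      rw [this]; simp
  | succ n ih =>
    intro w
    by_cases hc : c < d w
    · rw [← mu_cylM hμ]
      gcongr
      intro χ h; exact h.1
    · have hsub : {χ | χ ∈ cylM w ∧ ∃ k ≤ n + 1, c < d (preM χ (w.length + k))} ⊆
          {χ | χ ∈ cylM (w ++ [false]) ∧ ∃ k ≤ n, c < d (preM χ ((w ++ [false]).length + k))} ∪
          {χ | χ ∈ cylM (w ++ [true]) ∧ ∃ k ≤ n, c < d (preM χ ((w ++ [true]).length + k))} := by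
        rintro χ ⟨h1, k, hk, h⟩
        rcases k with _ | k
        · rw [add_zero, show preM χ w.length = w from h1] at h
          exact absurd h hc
        · have h' : c < d (preM χ (w.length + 1 + k)) := by
            rwa [show w.length + 1 + k = w.length + (k+1) by ring]
          rw [cylM_split] at h1
          rcases h1 with h1 | h1
          · left; exact ⟨h1, k, by omega, by simpa using h'⟩
          · right; exact ⟨h1, k, by omega, by simpa using h'⟩
      calc _ ≤ ENNReal.ofReal c * (_ + _) := by
            gcongr
            exact (measure_mono hsub).trans (measure_union_le _ _)
        _ ≤ ENNReal.ofReal (d (w ++ [false])) * (1 / 2) ^ (w ++ [false]).length +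
            ENNReal.ofReal (d (w ++ [true])) * (1 / 2) ^ (w ++ [true]).length := by
            rw [mul_add]; exact add_le_add (ih _) (ih _)
        _ = ENNReal.ofReal (d w) * (1 / 2) ^ w.length := by
            have h2 : ENNReal.ofReal (d w) =
              (ENNReal.ofReal (d (w ++ [false])) + ENNReal.ofReal (d (w ++ [true]))) * (1 / 2) := by
              rw [hd.2 w, ENNReal.ofReal_div_of_pos (by norm_num),
                ENNReal.ofReal_add (hd.1 _) (hd.1 _)]
              simp [div_eq_mul_inv]
            rw [h2]
            simp only [List.length_append, List.length_singleton, pow_succ]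
            ring

lemma ville_all {μ : Measure (ℕ → Bool)} (hμ : IsFairCoin μ) {d : List Bool → ℝ}
    (hd : IsMartingale d) (c : ℝ) :
    ENNReal.ofReal c * μ {χ | Succeeds d χ} ≤ ENNReal.ofReal (d []) := by
  have hm : Monotone fun n : ℕ =>
      {χ | χ ∈ cylM [] ∧ ∃ k ≤ n, c < d (preM χ (([] : List Bool).length + k))} := by
    rintro a b hab χ ⟨h, k, hk, h'⟩
    exact ⟨h, k, hk.trans hab, h'⟩
  have hsub : {χ | Succeeds d χ} ⊆ ⋃ n : ℕ,
      {χ | χ ∈ cylM [] ∧ ∃ k ≤ n, c < d (preM χ (([] : List Bool).length + k))} := by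
    intro χ h
    obtain ⟨k, hk⟩ := h c
    refine Set.mem_iUnion.2 ⟨k, by simp [cylM, preM], k, le_rfl, ?_⟩
    simpa [preM] using hk
  calc _ ≤ ENNReal.ofReal c * _ := mul_le_mul_right (measure_mono hsub) _
    _ ≤ _ := by
      rw [hm.measure_iUnion, ENNReal.mul_iSup]
      refine iSup_le fun n => ?_
      simpa using ville_s6 hμ hd c n []

lemma succ_null {μ : Measure (ℕ → Bool)} (hμ : IsFairCoin μ) {d : List Bool → ℝ}
    (hd : IsMartingale d) : μ {χ | Succeeds d χ} = 0 := by
  have := hμ.1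
  by_contra h0
  have hfin : μ {χ | Succeeds d χ} ≠ ⊤ := measure_ne_top _ _
  have hpos : 0 < (μ {χ | Succeeds d χ}).toReal := ENNReal.toReal_pos h0 hfin
  have h := ville_all hμ hd ((d [] + 1) / (μ {χ | Succeeds d χ}).toReal)
  have hd0 := hd.1 []
  rw [← ENNReal.ofReal_toReal hfin, ← ENNReal.ofReal_mul (by positivity),
    ENNReal.toReal_ofReal hpos.le, div_mul_cancel₀ _ hpos.ne',
    ENNReal.ofReal_le_ofReal_iff hd0] at h
  linarith

lemma exists_mart {μ : Measure (ℕ → Bool)} (hμ : IsFairCoin μ) {A : Set (ℕ → Bool)}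
    (hA : μ A = 0) : ∃ d : List Bool → ℝ, IsMartingale d ∧ ∀ χ ∈ A, Succeeds d χ := by
  have := hμ.1
  have hU : ∀ n : ℕ, ∃ U ⊇ A, IsOpen U ∧ μ U < (1 / 2 : ENNReal) ^ n := fun n =>
    Set.exists_isOpen_lt_of_lt A _ (by rw [hA]; exact ENNReal.pow_pos (by simp) n)
  choose U hAU hUo hUm using hU
  let ν : Measure (ℕ → Bool) := Measure.sum fun n => μ.restrict (U n)
  have hν : IsFiniteMeasure ν := by
    constructor
    rw [Measure.sum_apply _ MeasurableSet.univ]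
    refine lt_of_le_of_lt (b := ∑' n : ℕ, (1 / 2 : ENNReal) ^ n) ?_ ?_
    · refine ENNReal.tsum_le_tsum fun n => ?_
      simpa using (hUm n).le
    · rw [ENNReal.tsum_geometric]
      simp
  refine ⟨fun w => (ν (cylM w)).toReal * 2 ^ w.length, ⟨fun w => by positivity, fun w => ?_⟩, ?_⟩
  · have h1 : ν (cylM w) = ν (cylM (w ++ [false])) + ν (cylM (w ++ [true])) := by
      conv_lhs => rw [cylM_split w]
      exact measure_union (cylM_disj w) (measurable_cylM _)
    simp only [h1, ENNReal.toReal_add (measure_ne_top ν _) (measure_ne_top ν _)]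
    simp only [List.length_append, List.length_singleton, pow_succ]
    ring
  · intro χ hχ c
    obtain ⟨N, hN⟩ := exists_nat_gt c
    obtain ⟨k, hk⟩ := open_cylM (U := ⋂ n ∈ Finset.range N, U n)
      (isOpen_biInter_finset fun n _ => hUo n) (χ := χ)
      (by simp only [Set.mem_iInter]; exact fun n _ => hAU n hχ)
    refine ⟨k, hN.trans_le ?_⟩
    change (N : ℝ) ≤ (ν (cylM (preM χ k))).toReal * 2 ^ (preM χ k).length
    have h1 : (N : ENNReal) * (1 / 2) ^ k ≤ ν (cylM (preM χ k)) := by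
      rw [Measure.sum_apply _ (measurable_cylM _)]
      refine le_trans ?_ (ENNReal.sum_le_tsum (Finset.range N))
      have : ∀ n ∈ Finset.range N, μ.restrict (U n) (cylM (preM χ k)) = (1 / 2) ^ k := by
        intro n hn
        rw [Measure.restrict_apply (measurable_cylM _), Set.inter_eq_left.2, mu_cylM hμ,
          preM_length]
        exact hk.trans (Set.biInter_subset_of_mem hn)
      rw [Finset.sum_congr rfl this]
      simp
    have h2 := ENNReal.toReal_mono (measure_ne_top ν _) h1
    rw [preM_length]
    simp only [one_div, ENNReal.toReal_mul, ENNReal.toReal_natCast, ENNReal.toReal_pow,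
      ENNReal.toReal_inv, ENNReal.toReal_ofNat, inv_pow] at h2
    rwa [← div_eq_mul_inv, div_le_iff₀ (by positivity)] at h2

theorem null_iff_exists_martingale (μ : Measure (ℕ → Bool)) (hμ : IsFairCoin μ)
    (C : Set (ℕ → Bool)) :
    (∃ A : Set (ℕ → Bool), MeasurableSet A ∧ μ A = 0 ∧ C ⊆ A) ↔
      ∃ d : List Bool → ℝ, IsMartingale d ∧ ∀ χ ∈ C, Succeeds d χ := by
  constructor
  · rintro ⟨A, -, hA, hC⟩
    obtain ⟨d, hd, h⟩ := exists_mart hμ hA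
    exact ⟨d, hd, fun χ hχ => h χ (hC hχ)⟩
  · rintro ⟨d, hd, h⟩
    obtain ⟨A, h1, h2, h3⟩ := exists_measurable_superset_of_null (succ_null hμ hd)
    exact ⟨A, h2, h3, fun χ hχ => h1 (h χ hχ)⟩
end

section
/- There exists a martingale d that succeeds on the characteristic sequence χ_L of every language L with the following property: for infinitely many natural numbers n ≥ 16, the Boolean function L n has decision tree depth at most n·(1 − 2·log₂(log₂ n)/log₂ n) (where log₂ denotes the real base-2 logarithm and the decision tree depth, a natural number, is compared with this real value). -/
/-- A decision tree on `n` variables: a leaf with a Boolean label, or a node querying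
a variable with two subtrees. -/
inductive DTree (n : ℕ) where
  | leaf : Bool → DTree n
  | node : Fin n → DTree n → DTree n → DTree n

/-- Evaluation of a decision tree. -/
def DTree.eval {n : ℕ} : DTree n → (Fin n → Bool) → Bool
  | .leaf b, _ => b
  | .node i t₀ t₁, x => if x i then t₁.eval x else t₀.eval x

/-- Depth of a decision tree. -/
def DTree.depth {n : ℕ} : DTree n → ℕ
  | .leaf _ => 0
  | .node _ t₀ t₁ => 1 + max t₀.depth t₁.depth

/-- `f` is computed by a decision tree of depth at most `k`. -/
def HasDTreeDepthLE {n : ℕ} (f : (Fin n → Bool) → Bool) (k : ℕ) : Prop :=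
  ∃ t : DTree n, t.depth ≤ k ∧ ∀ x, t.eval x = f x

open Classical in
/-- Functions computed by trees of depth at most `k`. -/
noncomputable def TT (n : ℕ) : ℕ → Finset ((Fin n → Bool) → Bool)
  | 0 => {fun _ => false, fun _ => true}
  | k+1 => ((Finset.univ : Finset (Fin n)) ×ˢ (TT n k ×ˢ TT n k)).image
      (fun p x => if x p.1 then p.2.2 x else p.2.1 x)

lemma TT_card (n k : ℕ) : n * (TT n k).card ≤ (2 * n) ^ (2 ^ k) := by
  classical
  induction k with
  | zero =>
    have : (TT n 0).card ≤ 2 := by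
      unfold TT
      exact Finset.card_le_two
    simp only [pow_zero, pow_one]
    nlinarith
  | succ k ih =>
    have h : (TT n (k+1)).card ≤ n * ((TT n k).card * (TT n k).card) := by
      rw [TT]
      refine Finset.card_image_le.trans ?_
      simp [Finset.card_product]
    calc n * (TT n (k+1)).card ≤ n * (n * ((TT n k).card * (TT n k).card)) :=
          Nat.mul_le_mul_left _ h
      _ = (n * (TT n k).card) ^ 2 := by ring
      _ ≤ ((2 * n) ^ (2 ^ k)) ^ 2 := Nat.pow_le_pow_left ih 2
      _ = _ := by rw [← pow_mul, ← pow_succ]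

lemma TT_const (n : ℕ) (hn : 0 < n) (b : Bool) (k : ℕ) : (fun _ => b) ∈ TT n k := by
  classical
  induction k with
  | zero => cases b <;> simp [TT]
  | succ k ih =>
    rw [TT, Finset.mem_image]
    refine ⟨(⟨0, hn⟩, (fun _ => b), (fun _ => b)), by simp [ih], ?_⟩
    funext x
    simp

lemma TT_mem (n : ℕ) (hn : 0 < n) (t : DTree n) : ∀ k, t.depth ≤ k → t.eval ∈ TT n k := by
  classical
  induction t with
  | leaf b => intro k _; exact TT_const n hn b k
  | node i t₀ t₁ h0 h1 =>
    intro k hk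
    simp only [DTree.depth] at hk
    obtain ⟨k, rfl⟩ : ∃ j, k = j + 1 := ⟨k - 1, by omega⟩
    rw [TT, Finset.mem_image]
    refine ⟨(i, t₀.eval, t₁.eval), ?_, ?_⟩
    · simp only [Finset.mem_product, Finset.mem_univ, true_and]
      exact ⟨h0 k (by omega), h1 k (by omega)⟩
    · funext x
      simp [DTree.eval]

/-- The property of interest. -/
def Good (n : ℕ) (f : (Fin n → Bool) → Bool) : Prop :=
  16 ≤ n ∧ ∃ k : ℕ, HasDTreeDepthLE f k ∧ (k : ℝ) ≤
    (n : ℝ) * (1 - 2 * Real.logb 2 (Real.logb 2 (n : ℝ)) / Real.logb 2 (n : ℝ))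

open Classical in
noncomputable def FF (n : ℕ) : Finset ((Fin n → Bool) → Bool) := Finset.univ.filter (Good n)

lemma num_bound (n k : ℕ) (hn : 16 ≤ n) (hk : (k : ℝ) ≤
    (n : ℝ) * (1 - 2 * Real.logb 2 (Real.logb 2 (n : ℝ)) / Real.logb 2 (n : ℝ))) :
    ((2 * n : ℕ) : ℝ) ^ (2 ^ k) ≤ 2 ^ (2 ^ (n - 1)) := by
  have hnR : (16 : ℝ) ≤ n := by exact_mod_cast hn
  set l := Real.logb 2 (n : ℝ) with hl
  have hl4 : 4 ≤ l := by
    rw [hl, Real.le_logb_iff_rpow_le (by norm_num) (by linarith)]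
    norm_num; linarith
  set m := Real.logb 2 l with hm
  have hm2 : 2 ≤ m := by
    rw [hm, Real.le_logb_iff_rpow_le (by norm_num) (by linarith)]
    norm_num; linarith
  have h2l : (2 : ℝ) ^ l = n := Real.rpow_logb (by norm_num) (by norm_num) (by linarith)
  have h2m : (2 : ℝ) ^ m = l := Real.rpow_logb (by norm_num) (by norm_num) (by linarith)
  have hln : l ≤ n := by
    rw [hl, Real.logb_le_iff_le_rpow (by norm_num) (by linarith), Real.rpow_natCast]
    exact_mod_cast Nat.lt_two_pow_self.le
  have hk2 : (k : ℝ) + m + 1 ≤ ((n - 1 : ℕ) : ℝ) := by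
    rw [Nat.cast_sub (by omega)]
    have : (n : ℝ) * (1 - 2 * m / l) ≤ n - 2 * m := by
      have h1 : (n : ℝ) * (1 - 2 * m / l) = n - 2 * m * (n / l) := by ring
      have h2 : 1 ≤ (n : ℝ) / l := by rw [le_div_iff₀ (by linarith)]; linarith
      rw [h1]; nlinarith
    push_cast
    linarith
  have h3 : (2 : ℝ) ^ k * (1 + l) ≤ (2 : ℝ) ^ (n - 1) := by
    calc (2 : ℝ) ^ k * (1 + l) ≤ (2 : ℝ) ^ k * (l * 2) := by
          gcongr; linarith
      _ = (2 : ℝ) ^ ((k : ℝ) + m + 1) := by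
          rw [Real.rpow_add (by norm_num), Real.rpow_add (by norm_num), h2m, Real.rpow_natCast]
          simp; ring
      _ ≤ (2 : ℝ) ^ (((n - 1 : ℕ) : ℝ)) := Real.rpow_le_rpow_of_exponent_le (by norm_num) hk2
      _ = _ := Real.rpow_natCast _ _
  have h4 : ((2 * n : ℕ) : ℝ) = (2 : ℝ) ^ (1 + l) := by
    rw [Real.rpow_add (by norm_num), h2l]; simp
  rw [h4, ← Real.rpow_natCast, ← Real.rpow_mul (by norm_num),
    ← Real.rpow_natCast 2 (2 ^ (n-1))]
  apply Real.rpow_le_rpow_of_exponent_le (by norm_num)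
  push_cast
  linarith

lemma FF_card (n : ℕ) : ((FF n).card : ℝ) ≤ 2 ^ (2 ^ (n - 1)) := by
  classical
  rcases (FF n).eq_empty_or_nonempty with h | ⟨f, hf⟩
  · rw [h]; simp
  · obtain ⟨hn, k, _, hk⟩ := (Finset.mem_filter.1 hf).2
    set B := (n : ℝ) * (1 - 2 * Real.logb 2 (Real.logb 2 (n : ℝ)) / Real.logb 2 (n : ℝ)) with hB
    have hB0 : 0 ≤ B := (Nat.cast_nonneg k).trans hk
    refine le_trans ?_ (num_bound n ⌊B⌋₊ hn (Nat.floor_le hB0))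
    have hsub : FF n ⊆ TT n ⌊B⌋₊ := by
      intro g hg
      obtain ⟨_, j, ⟨t, ht, hte⟩, hj⟩ := (Finset.mem_filter.1 hg).2
      have : t.eval = g := funext hte
      rw [← this]
      exact TT_mem n (by omega) t _ (ht.trans (Nat.le_floor hj))
    have h1 := Finset.card_le_card hsub
    have h2 := TT_card n ⌊B⌋₊
    have h3 : (FF n).card ≤ (2 * n) ^ (2 ^ ⌊B⌋₊) :=
      h1.trans ((Nat.le_mul_of_pos_left _ (by omega)).trans h2)
    exact_mod_cast h3

/-- Betting factor. -/
noncomputable def cc (n : ℕ) (f : (Fin n → Bool) → Bool) (i : ℕ) (b : Bool) : ℝ :=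
  if i ∈ Finset.Ico (2 ^ n - 1) (2 ^ n - 1 + 2 ^ n) then
    (if b = f (natToBits n (i - (2 ^ n - 1))) then 2 else 0) else 1

lemma cc_nonneg (n f i b) : 0 ≤ cc n f i b := by
  unfold cc; split_ifs <;> norm_num

lemma cc_le (n f i b) : cc n f i b ≤ 2 := by
  unfold cc; split_ifs <;> norm_num

lemma cc_add (n f i) : cc n f i false + cc n f i true = 2 := by
  unfold cc
  split_ifs with h1 h2 h3 h3 <;> first | norm_num | skip
  · rw [← h2] at h3; cases h3
  · cases h : f (natToBits n (i - (2 ^ n - 1))) <;> simp_all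

/-- Martingale betting on `f` in block `n`. -/
noncomputable def ee (n : ℕ) (f : (Fin n → Bool) → Bool) (w : List Bool) : ℝ :=
  ∏ i ∈ Finset.range w.length, cc n f i (w.getD i false)

lemma ee_append (n f) (w : List Bool) (b : Bool) : ee n f (w ++ [b]) = ee n f w * cc n f w.length b := by
  unfold ee
  rw [List.length_append, List.length_singleton, Finset.prod_range_succ]
  congr 1
  · apply Finset.prod_congr rfl
    intro i hi
    rw [List.getD_append _ _ _ _ (Finset.mem_range.1 hi)]
  · simp

lemma ee_nonneg (n f w) : 0 ≤ ee n f w := Finset.prod_nonneg fun _ _ => cc_nonneg _ _ _ _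

lemma ee_le (n f w) : ee n f w ≤ 2 ^ w.length := by
  unfold ee
  refine (Finset.prod_le_prod (fun _ _ => cc_nonneg _ _ _ _) (fun _ _ => cc_le _ _ _ _)).trans ?_
  simp

noncomputable def dd (n : ℕ) (w : List Bool) : ℝ := (2 ^ (2 ^ n))⁻¹ * ∑ f ∈ FF n, ee n f w

lemma dd_nonneg (n w) : 0 ≤ dd n w :=
  mul_nonneg (by positivity) (Finset.sum_nonneg fun _ _ => ee_nonneg _ _ _)

lemma dd_avg (n) (w : List Bool) : dd n (w ++ [false]) + dd n (w ++ [true]) = 2 * dd n w := by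
  unfold dd
  rw [← mul_add, ← Finset.sum_add_distrib, mul_left_comm, Finset.mul_sum (FF n) _ (2 : ℝ)]
  congr 1
  apply Finset.sum_congr rfl
  intro f _
  rw [ee_append, ee_append, ← mul_add, cc_add, mul_comm]

lemma dd_le (n w) : dd n w ≤ 2 ^ w.length * (2 * (1 / 2) ^ n) := by
  have h1 : ∑ f ∈ FF n, ee n f w ≤ 2 ^ (2 ^ (n - 1)) * 2 ^ w.length := by
    refine (Finset.sum_le_card_nsmul _ _ (2 ^ w.length) fun f _ => ee_le n f w).trans ?_
    rw [nsmul_eq_mul]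
    exact mul_le_mul_of_nonneg_right (FF_card n) (by positivity)
  have h2 : ((2 : ℝ) ^ (2 ^ n))⁻¹ * 2 ^ (2 ^ (n - 1)) ≤ 2 * (1 / 2) ^ n := by
    rw [inv_mul_le_iff₀ (by positivity), one_div, inv_pow, ← mul_assoc, ← div_eq_mul_inv,
      le_div_iff₀ (by positivity), ← pow_add, ← pow_succ]
    apply pow_le_pow_right₀ (by norm_num)
    rcases n with _ | n
    · simp
    · have := (Nat.lt_two_pow_self (n := n))
      simp only [Nat.add_sub_cancel, pow_succ]
      omega
  calc dd n w ≤ (2 ^ (2 ^ n))⁻¹ * (2 ^ (2 ^ (n - 1)) * 2 ^ w.length) :=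
        mul_le_mul_of_nonneg_left h1 (by positivity)
    _ = ((2 ^ (2 ^ n))⁻¹ * 2 ^ (2 ^ (n - 1))) * 2 ^ w.length := by ring
    _ ≤ (2 * (1 / 2) ^ n) * 2 ^ w.length := mul_le_mul_of_nonneg_right h2 (by positivity)
    _ = _ := by ring

lemma dd_summable (w) : Summable fun n => dd n w :=
  Summable.of_nonneg_of_le (fun n => dd_nonneg n w) (fun n => dd_le n w)
    ((summable_geometric_two.mul_left 2).mul_left _)

lemma dd_success (L : ∀ n : ℕ, (Fin n → Bool) → Bool) (χ : ℕ → Bool) (h : IsCharSeq L χ)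
    (n k : ℕ) (hg : Good n (L n)) (hk : 2 ^ (n + 1) ≤ k) :
    1 ≤ dd n (List.ofFn fun i : Fin k => χ i) := by
  classical
  have hmem : L n ∈ FF n := Finset.mem_filter.2 ⟨Finset.mem_univ _, hg⟩
  have he : ee n (L n) (List.ofFn fun i : Fin k => χ i) = 2 ^ (2 ^ n) := by
    unfold ee
    rw [List.length_ofFn]
    have : ∀ i ∈ Finset.range k, cc n (L n) i ((List.ofFn fun i : Fin k => χ i).getD i false)
        = if i ∈ Finset.Ico (2 ^ n - 1) (2 ^ n - 1 + 2 ^ n) then 2 else 1 := by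
      intro i hi
      have hi' := Finset.mem_range.1 hi
      rw [List.getD_eq_getElem _ _ (by simpa using hi'), List.getElem_ofFn]
      unfold cc
      split_ifs with h1 h2
      · rfl
      · exfalso
        apply h2
        rw [Finset.mem_Ico] at h1
        have := h n (i - (2 ^ n - 1)) (by omega)
        rw [← this]
        congr 1
        simp only
        omega
      · rfl
    rw [Finset.prod_congr rfl this, Finset.prod_ite_mem, Finset.prod_const]
    congr 1
    rw [Finset.inter_eq_right.2]
    · simp
    · intro i hi
      rw [Finset.mem_Ico] at hi
      rw [Finset.mem_range]
      rw [pow_succ] at hk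
      have : 0 < 2 ^ n := by positivity
      omega
  unfold dd
  have := Finset.single_le_sum (f := fun f => ee n f (List.ofFn fun i : Fin k => χ i))
    (fun f _ => ee_nonneg n f _) hmem
  simp only [he] at this
  rw [le_inv_mul_iff₀ (by positivity), mul_one]
  exact this

theorem sublinear_dtree_depth_measure_zero :
    ∃ d : List Bool → ℝ, IsMartingale d ∧
      ∀ L : (∀ n : ℕ, (Fin n → Bool) → Bool), ∀ χ : ℕ → Bool, IsCharSeq L χ →
        {n : ℕ | 16 ≤ n ∧ ∃ k : ℕ, HasDTreeDepthLE (L n) k ∧ (k : ℝ) ≤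
            (n : ℝ) * (1 - 2 * Real.logb 2 (Real.logb 2 (n : ℝ)) / Real.logb 2 (n : ℝ))}.Infinite →
        Succeeds d χ := by
  refine ⟨fun w => ∑' n, dd n w, ⟨fun w => tsum_nonneg fun n => dd_nonneg n w, fun w => ?_⟩, ?_⟩
  · simp only
    rw [← (dd_summable _).tsum_add (dd_summable _)]
    simp only [dd_avg, tsum_mul_left]
    ring
  · intro L χ h hinf C
    obtain ⟨N, hN⟩ := exists_nat_gt C
    obtain ⟨S, hS, hcard⟩ := hinf.exists_subset_card_eq N
    refine ⟨2 ^ (S.sup id + 1), hN.trans_le ?_⟩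
    refine le_trans ?_ ((dd_summable _).sum_le_tsum S fun n _ => dd_nonneg n _)
    rw [← hcard]
    refine le_trans (by simp) (Finset.card_nsmul_le_sum S _ (1 : ℝ) fun n hn => ?_)
    refine dd_success L χ h n _ (hS hn) ?_
    apply Nat.pow_le_pow_right (by norm_num)
    have := Finset.le_sup (f := id) hn
    simp only [id] at this ⊢
    exact Nat.succ_le_succ this
end
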